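/- For every integer t ≥ 1 and every integer n ≥ 7t−1, sbal(n, (2t−1)K_2) = bal(n, 2tK_2) = bal(n, (2t+1)K_2) = ex(n, tK_2) = C(t−1, 2) + (t−1)(n−t+1), where C(t−1,2) denotes the binomial coefficient (t−1 choose 2). -/

import Mathlib

/-- The set of red edges of a 2-edge-colouring of `K_n`
    (`true` = red, `false` = blue). -/
def redEdges (n : ℕ) (c : Sym2 (Fin n) → Bool) : Finset (Sym2 (Fin n)) :=
  (⊤ : SimpleGraph (Fin n)).edgeFinset.filter (fun e => c e = true)

/-- The set of blue edges of a 2-edge-colouring of `K_n`. -/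
def blueEdges (n : ℕ) (c : Sym2 (Fin n) → Bool) : Finset (Sym2 (Fin n)) :=
  (⊤ : SimpleGraph (Fin n)).edgeFinset.filter (fun e => c e = false)

/-- A copy of the matching `mK_2` in a 2-edge-coloured `K_n` having exactly `r` red edges:
`m` pairwise vertex-disjoint edges, exactly `r` of which are red. -/
def MatchingCopy (n : ℕ) (c : Sym2 (Fin n) → Bool) (m r : ℕ) : Prop :=
  ∃ f : Fin m → Fin n × Fin n,
    (Function.Injective fun p : Fin m × Bool => if p.2 then (f p.1).1 else (f p.1).2) ∧
    (Finset.univ.filter fun i : Fin m => c s((f i).1, (f i).2) = true).card = r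

/-- `bal(n, mK_2)`: the least `k` such that every 2-edge-colouring of `K_n` with
`min{|R|,|B|} > k` contains a balanced copy of `mK_2`, i.e. one with `⌊m/2⌋` or `⌈m/2⌉`
red edges (these coincide for `m` even). -/
noncomputable def balMatching (n m : ℕ) : ℕ :=
  sInf {k : ℕ | ∀ c : Sym2 (Fin n) → Bool,
    k < min (redEdges n c).card (blueEdges n c).card →
    MatchingCopy n c m (m / 2) ∨ MatchingCopy n c m ((m + 1) / 2)}

/-- `sbal(n, mK_2)` for odd `m`: the least `k` such that every 2-edge-colouring of `K_n`
with `min{|R|,|B|} > k` contains both a `(⌊m/2⌋,⌈m/2⌉)`-coloured and a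
`(⌈m/2⌉,⌊m/2⌋)`-coloured copy of `mK_2`. -/
noncomputable def sbalMatching (n m : ℕ) : ℕ :=
  sInf {k : ℕ | ∀ c : Sym2 (Fin n) → Bool,
    k < min (redEdges n c).card (blueEdges n c).card →
    MatchingCopy n c m (m / 2) ∧ MatchingCopy n c m ((m + 1) / 2)}

/-- A graph `A` contains a matching of `t` pairwise vertex-disjoint edges,
i.e. a copy of `tK_2`. -/
def HasMatching {N : ℕ} (A : SimpleGraph (Fin N)) (t : ℕ) : Prop :=
  ∃ f : Fin t → Fin N × Fin N,
    (Function.Injective fun p : Fin t × Bool => if p.2 then (f p.1).1 else (f p.1).2) ∧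
    ∀ i : Fin t, A.Adj (f i).1 (f i).2

/-- The Turán number `ex(n, tK_2)`: the maximum number of edges of a graph on `n`
vertices containing no copy of the matching `tK_2`. -/
noncomputable def exMatching (n t : ℕ) : ℕ :=
  sSup {k : ℕ | ∃ A : SimpleGraph (Fin n), ¬ HasMatching A t ∧ A.edgeSet.ncard = k}

/-- The injectivity condition in `MatchingCopy` and `HasMatching` is injectivity of `endpoints f`. -/
def endpoints {V : Type*} {m : ℕ} (f : Fin m → V × V) (p : Fin m × Bool) : V :=
  if p.2 then (f p.1).1 else (f p.1).2

theorem endpoints_cons_injective {V : Type*} {m : ℕ} {f : Fin m → V × V} {u v : V}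
    (hf : Function.Injective (endpoints f)) (huv : u ≠ v)
    (hu : ∀ p, endpoints f p ≠ u) (hv : ∀ p, endpoints f p ≠ v) :
    Function.Injective (endpoints (Fin.cons (u, v) f : Fin (m + 1) → V × V)) := by
  have key : ∀ (i : Fin m) (b : Bool),
      endpoints (Fin.cons (u, v) f : Fin (m + 1) → V × V) (i.succ, b) = endpoints f (i, b) := by
    intro i b
    simp [endpoints]
  rintro ⟨i, b⟩ ⟨j, b'⟩ h
  induction i using Fin.cases with
  | zero =>
    induction j using Fin.cases with
    | zero => cases b <;> cases b' <;> simp_all [endpoints, huv.symm]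
    | succ j =>
      rw [key] at h
      have h1 := hu (j, b')
      have h2 := hv (j, b')
      rw [← h] at h1 h2
      cases b <;> simp [endpoints] at h1 h2
  | succ i =>
    induction j using Fin.cases with
    | zero =>
      rw [key] at h
      have h1 := hu (i, b)
      have h2 := hv (i, b)
      rw [h] at h1 h2
      cases b' <;> simp [endpoints] at h1 h2
    | succ j =>
      rw [key, key] at h
      have := hf h
      simp_all

theorem card_image_endpoints_le {V : Type*} [DecidableEq V] {m : ℕ} (f : Fin m → V × V) :
    (Finset.univ.image (endpoints f)).card ≤ 2 * m := by
  refine Finset.card_image_le.trans ?_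
  simp [mul_comm]

theorem HasMatching.succ_of_le {N t : ℕ} {G H : SimpleGraph (Fin N)} (hle : H ≤ G)
    {f : Fin t → Fin N × Fin N} (hf : Function.Injective (endpoints f))
    (hadj : ∀ i, H.Adj (f i).1 (f i).2) {u v : Fin N} (huv : G.Adj u v)
    (hu : ∀ p, endpoints f p ≠ u) (hv : ∀ p, endpoints f p ≠ v) : HasMatching G (t + 1) := by
  refine ⟨Fin.cons (u, v) f, endpoints_cons_injective hf huv.ne hu hv, fun i => ?_⟩
  induction i using Fin.cases with
  | zero => simpa using huv
  | succ i => simpa using hle (hadj i)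

theorem endpoints_ne_of_isolated {N t : ℕ} {H : SimpleGraph (Fin N)}
    {f : Fin t → Fin N × Fin N} (hadj : ∀ i, H.Adj (f i).1 (f i).2) {u : Fin N}
    (hu : ∀ w, ¬ H.Adj u w) (p : Fin t × Bool) : endpoints f p ≠ u := by
  rintro rfl
  obtain ⟨i, b⟩ := p
  cases b
  · exact hu _ (hadj i).symm
  · exact hu _ (hadj i)

theorem exists_adj_of_card_pos {N : ℕ} {G : SimpleGraph (Fin N)} [DecidableRel G.Adj]
    (h : 0 < G.edgeFinset.card) : ∃ u v, G.Adj u v := by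
  obtain ⟨e, he⟩ := Finset.card_pos.mp h
  induction e using Sym2.ind with
  | _ u v => exact ⟨u, v, by simpa using he⟩

/-- A graph with maximum degree at most `d` and more than `2dt` edges has a matching of size
`t + 1`. -/
theorem hasMatching_of_degree_le {N d : ℕ} (t : ℕ) (G : SimpleGraph (Fin N)) [DecidableRel G.Adj]
    (hd : ∀ v, G.degree v ≤ d) (he : 2 * d * t < G.edgeFinset.card) : HasMatching G (t + 1) := by
  induction t generalizing G with
  | zero =>
    obtain ⟨u, v, huv⟩ := exists_adj_of_card_pos (by omega)
    exact HasMatching.succ_of_le (f := fun i => i.elim0) le_rfl (fun p => p.1.elim0)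
      (fun i => i.elim0) huv (fun p => p.1.elim0) (fun p => p.1.elim0)
  | succ t ih =>
    obtain ⟨u, v, huv⟩ := exists_adj_of_card_pos (G := G) (by omega)
    have hle : (G.deleteIncidenceSet u).deleteIncidenceSet v ≤ G :=
      (SimpleGraph.deleteIncidenceSet_le _ _).trans (SimpleGraph.deleteIncidenceSet_le _ _)
    obtain ⟨f, hf, hadj⟩ := ih ((G.deleteIncidenceSet u).deleteIncidenceSet v)
      (fun w => (SimpleGraph.degree_le_of_le hle).trans (hd w)) (by
        rw [SimpleGraph.card_edgeFinset_deleteIncidenceSet,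
          SimpleGraph.card_edgeFinset_deleteIncidenceSet]
        have h1 := hd u
        have h2 : (G.deleteIncidenceSet u).degree v ≤ d :=
          (SimpleGraph.degree_le_of_le (SimpleGraph.deleteIncidenceSet_le _ _)).trans (hd v)
        have h3 : 2 * d * (t + 1) = 2 * d * t + 2 * d := by ring
        omega)
    refine HasMatching.succ_of_le hle hf hadj huv (endpoints_ne_of_isolated hadj fun w hw => ?_)
      (endpoints_ne_of_isolated hadj fun w hw => ?_)
    · simp [SimpleGraph.deleteIncidenceSet_adj] at hw
    · simp [SimpleGraph.deleteIncidenceSet_adj] at hw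

theorem choose_two_add (m p : ℕ) :
    (m + p).choose 2 = m.choose 2 + m * p + p.choose 2 := by
  induction p with
  | zero => simp
  | succ p ih =>
    rw [← add_assoc, Nat.choose_succ_succ' (m + p) 1, Nat.choose_succ_succ' p 1, ih]
    simp only [Nat.choose_one_right, Nat.reduceAdd]
    ring

/-- The Erdős–Gallai bound for matchings, in the range where the vertex cover construction is
extremal. -/
theorem hasMatching_of_lt_card_edgeFinset {N : ℕ} (t : ℕ) (G : SimpleGraph (Fin N))
    [DecidableRel G.Adj] (S : Finset (Fin N)) (hS : ∀ u v, G.Adj u v → u ∈ S)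
    (hcard : 5 * t ≤ S.card) (he : t.choose 2 + t * (S.card - t) < G.edgeFinset.card) :
    HasMatching G (t + 1) := by
  induction t generalizing G S with
  | zero =>
    exact hasMatching_of_degree_le (d := N) 0 G
      (fun v => (G.degree_lt_card_verts v).le.trans (by simp)) (by simpa using he)
  | succ t ih =>
    by_cases hdeg : ∀ v, G.degree v ≤ 2 * (t + 1)
    · refine hasMatching_of_degree_le (t + 1) G hdeg (lt_of_le_of_lt ?_ he)
      obtain ⟨k, hk⟩ := Nat.exists_eq_add_of_le hcard
      have h1 : S.card - (t + 1) = 4 * (t + 1) + k := by omega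
      rw [h1]
      nlinarith [Nat.zero_le ((t + 1) * k), Nat.zero_le ((t + 1).choose 2)]
    · push Not at hdeg
      obtain ⟨v, hv⟩ := hdeg
      have hnS : G.neighborFinset v ⊆ S.erase v := by
        intro w hw
        rw [SimpleGraph.mem_neighborFinset] at hw
        exact Finset.mem_erase.mpr ⟨hw.ne', hS w v hw.symm⟩
      have hvS : v ∈ S := by
        obtain ⟨w, hw⟩ := Finset.card_pos.mp (by
          rw [SimpleGraph.card_neighborFinset_eq_degree]; omega : 0 < (G.neighborFinset v).card)
        exact hS v w (by simpa using hw)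
      have hcS := Finset.card_erase_of_mem hvS
      have hdS : G.degree v ≤ S.card - 1 := by
        rw [← hcS, ← SimpleGraph.card_neighborFinset_eq_degree]
        exact Finset.card_le_card hnS
      have hle := G.deleteIncidenceSet_le v
      obtain ⟨f, hf, hadj⟩ := ih (G.deleteIncidenceSet v) (S.erase v)
        (fun a b hab => by
          rw [SimpleGraph.deleteIncidenceSet_adj] at hab
          exact Finset.mem_erase.mpr ⟨hab.2.1, hS a b hab.1⟩)
        (by omega) (by
          rw [SimpleGraph.card_edgeFinset_deleteIncidenceSet, hcS]
          have h1 : S.card - 1 - t = S.card - (t + 1) := by omega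
          obtain ⟨k, hk⟩ := Nat.exists_eq_add_of_le hcard
          have h2 := choose_two_add t 1
          rw [h1]
          have h3 : (t + 1) * (S.card - (t + 1)) =
            t * (S.card - (t + 1)) + (S.card - (t + 1)) := by ring
          simp only [mul_one, show Nat.choose 1 2 = 0 from rfl] at h2
          omega)
      obtain ⟨w, hw, hwf⟩ : ∃ w ∈ G.neighborFinset v, w ∉ Finset.univ.image (endpoints f) := by
        apply Finset.exists_mem_notMem_of_card_lt_card
        rw [SimpleGraph.card_neighborFinset_eq_degree]
        exact (card_image_endpoints_le f).trans_lt (by omega)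
      refine HasMatching.succ_of_le hle hf hadj (u := v) (v := w) (by simpa using hw)
        (endpoints_ne_of_isolated hadj fun x hx => ?_) (fun p hp => hwf ?_)
      · simp [SimpleGraph.deleteIncidenceSet_adj] at hx
      · exact Finset.mem_image.mpr ⟨p, Finset.mem_univ _, hp⟩

theorem hasMatching_of_lt_ncard_edgeSet {n s : ℕ} (hn : 5 * s ≤ n) (G : SimpleGraph (Fin n))
    (he : s.choose 2 + s * (n - s) < G.edgeSet.ncard) : HasMatching G (s + 1) := by
  classical
  refine hasMatching_of_lt_card_edgeFinset s G Finset.univ (by simp) (by simpa using hn) ?_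
  rwa [Finset.card_univ, Fintype.card_fin, ← Set.ncard_coe_finset, SimpleGraph.coe_edgeFinset]

/-- The number of edges of colour `true` in a matching given by an enumeration of its endpoints. -/
def redCount {V : Type*} {m : ℕ} (c : Sym2 V → Bool) (g : Fin m × Bool → V) : ℕ :=
  (Finset.univ.filter fun i : Fin m => c s(g (i, true), g (i, false)) = true).card

theorem redCount_le_update {V : Type*} {m : ℕ} (c : Sym2 V → Bool)
    (g : Fin m × Bool → V) (p : Fin m × Bool) (x : V) :
    redCount c g ≤ redCount c (Function.update g p x) + 1 := by
  unfold redCount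
  refine (Finset.card_le_card (t := insert p.1 (Finset.univ.filter fun i : Fin m =>
    c s(Function.update g p x (i, true), Function.update g p x (i, false)) = true)) ?_).trans
    (Finset.card_insert_le _ _)
  intro i hi
  by_cases hip : i = p.1
  · simp [hip]
  · have h (b : Bool) : (i, b) ≠ p := fun h => hip (by rw [← h])
    simpa [hip, h] using hi

theorem update_injective {α β : Type*} [DecidableEq α] {g : α → β} (hg : Function.Injective g)
    (p : α) {x : β} (hx : ∀ q, g q ≠ x) : Function.Injective (Function.update g p x) := by
  intro a b hab
  by_cases ha : a = p <;> by_cases hb : b = p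
  · rw [ha, hb]
  · subst ha
    simp only [Function.update_self, Function.update_of_ne hb] at hab
    exact absurd hab.symm (hx b)
  · subst hb
    simp only [Function.update_self, Function.update_of_ne ha] at hab
    exact absurd hab (hx a)
  · simp only [Function.update_of_ne ha, Function.update_of_ne hb] at hab
    exact hg hab

/-- Moving from one matching to another one endpoint at a time changes the number of red edges by
at most one in each step, so all intermediate values occur. -/
theorem exists_redCount_eq {V : Type*} [Fintype V] [DecidableEq V] {m r : ℕ} (c : Sym2 V → Bool)
    (hm : 2 * m < Fintype.card V) {h : Fin m × Bool → V} (hh : Function.Injective h)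
    (hr : redCount c h ≤ r) (g : Fin m × Bool → V) (hg : Function.Injective g)
    (hrg : r ≤ redCount c g) :
    ∃ k : Fin m × Bool → V, Function.Injective k ∧ redCount c k = r := by
  induction hd : (Finset.univ.filter fun p => g p ≠ h p).card using Nat.strong_induction_on
    generalizing g with
  | _ d ih =>
    subst hd
    rcases hrg.eq_or_lt with heq | hlt
    · exact ⟨g, hg, heq.symm⟩
    obtain ⟨p, hp⟩ : ∃ p, g p ≠ h p := by
      by_contra! hgh
      rw [funext hgh] at hlt
      omega
    by_cases hq : ∃ q, g q = h p
    · obtain ⟨q, hq⟩ := hq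
      have hqp : q ≠ p := by
        rintro rfl
        exact hp hq
      obtain ⟨x, hx⟩ : ∃ x, x ∉ Finset.univ.image g := by
        by_contra! hall
        have := Finset.card_le_card (fun x _ => hall x : (Finset.univ : Finset V) ⊆ _)
        have h2 := Finset.card_image_le (s := Finset.univ) (f := g)
        simp only [Finset.card_univ, Fintype.card_prod, Fintype.card_fin, Fintype.card_bool] at *
        omega
      have hx' : ∀ z, g z ≠ x := fun z hz => hx (Finset.mem_image.mpr ⟨z, Finset.mem_univ _, hz⟩)
      have h1 := update_injective hg q hx'
      have hr1 := redCount_le_update c g q x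
      rcases (by omega : r ≤ redCount c (Function.update g q x)).eq_or_lt with heq | hlt'
      · exact ⟨_, h1, heq.symm⟩
      have hpx : ∀ z, Function.update g q x z ≠ h p := by
        intro z hz
        by_cases hzq : z = q
        · subst hzq
          rw [Function.update_self] at hz
          exact hx' z (hq.trans hz.symm)
        · rw [Function.update_of_ne hzq] at hz
          exact hzq (hg (hz.trans hq.symm))
      have hr2 := redCount_le_update c (Function.update g q x) p (h p)
      refine ih _ (Finset.card_lt_card ?_) _ (update_injective h1 p hpx) (by omega) rfl
      refine Finset.ssubset_iff_of_subset (fun z hz => ?_) |>.mpr ⟨p, by simpa using hp, by simp⟩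
      simp only [Finset.mem_filter, Finset.mem_univ, true_and] at hz ⊢
      have hzp : z ≠ p := by
        rintro rfl
        simp at hz
      by_cases hzq : z = q
      · subst hzq
        rw [hq]
        exact fun h' => hqp (hh h').symm
      · simpa [hzp, hzq] using hz
    · push Not at hq
      have hr1 := redCount_le_update c g p (h p)
      refine ih _ (Finset.card_lt_card ?_) _ (update_injective hg p hq) (by omega) rfl
      refine Finset.ssubset_iff_of_subset (fun z hz => ?_) |>.mpr ⟨p, by simpa using hp, by simp⟩
      simp only [Finset.mem_filter, Finset.mem_univ, true_and] at hz ⊢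
      have hzp : z ≠ p := by
        rintro rfl
        simp at hz
      simpa [hzp] using hz

theorem matchingCopy_iff {n m r : ℕ} {c : Sym2 (Fin n) → Bool} :
    MatchingCopy n c m r ↔
      ∃ g : Fin m × Bool → Fin n, Function.Injective g ∧ redCount c g = r := by
  constructor
  · rintro ⟨f, hf, hr⟩
    exact ⟨endpoints f, hf, by simpa [redCount, endpoints] using hr⟩
  · rintro ⟨g, hg, hr⟩
    refine ⟨fun i => (g (i, true), g (i, false)), ?_, hr⟩
    convert hg using 1
    ext ⟨i, b⟩
    cases b <;> rfl

theorem MatchingCopy.of_le_of_le {n m r₁ r r₂ : ℕ} {c : Sym2 (Fin n) → Bool} (hm : 2 * m < n)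
    (h₁ : MatchingCopy n c m r₁) (h₂ : MatchingCopy n c m r₂) (hr₁ : r₁ ≤ r) (hr₂ : r ≤ r₂) :
    MatchingCopy n c m r := by
  rw [matchingCopy_iff] at *
  obtain ⟨g₁, hg₁, rfl⟩ := h₁
  obtain ⟨g₂, hg₂, rfl⟩ := h₂
  exact exists_redCount_eq c (by simpa using hm) hg₁ hr₁ g₂ hg₂ hr₂

theorem MatchingCopy.succ {n m r : ℕ} {c : Sym2 (Fin n) → Bool} (hm : 2 * m + 2 ≤ n)
    (h : MatchingCopy n c m r) :
    MatchingCopy n c (m + 1) r ∨ MatchingCopy n c (m + 1) (r + 1) := by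
  obtain ⟨f, hf, hr⟩ := h
  have hcard : 1 < (Finset.univ.image (endpoints f))ᶜ.card := by
    rw [Finset.card_compl, Fintype.card_fin]
    have := card_image_endpoints_le f
    omega
  obtain ⟨u, hu, v, hv, huv⟩ := Finset.one_lt_card.mp hcard
  simp only [Finset.mem_compl, Finset.mem_image, Finset.mem_univ, true_and, not_exists] at hu hv
  have hinj := endpoints_cons_injective hf huv hu hv
  have hcount := Fin.card_filter_univ_succ (fun i : Fin (m + 1) =>
    c s(((Fin.cons (u, v) f : Fin (m + 1) → Fin n × Fin n) i).1,
      ((Fin.cons (u, v) f : Fin (m + 1) → Fin n × Fin n) i).2) = true)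
  simp only [Fin.cons_zero, Fin.cons_succ, hr] at hcount
  split_ifs at hcount with huvc
  · exact Or.inr ⟨_, hinj, hcount⟩
  · exact Or.inl ⟨_, hinj, hcount⟩

theorem MatchingCopy.add {n m r : ℕ} {c : Sym2 (Fin n) → Bool} (h : MatchingCopy n c m r) (k : ℕ)
    (hm : 2 * (m + k) ≤ n) : ∃ r', r ≤ r' ∧ r' ≤ r + k ∧ MatchingCopy n c (m + k) r' := by
  induction k with
  | zero => exact ⟨r, le_rfl, le_rfl, h⟩
  | succ k ih =>
    obtain ⟨r', h₁, h₂, h₃⟩ := ih (by omega)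
    rcases h₃.succ (by omega) with h₄ | h₄
    · exact ⟨r', h₁, by omega, h₄⟩
    · exact ⟨r' + 1, by omega, by omega, h₄⟩

theorem matchingCopy_of_hasMatching_fromEdgeSet {n t : ℕ} (c : Sym2 (Fin n) → Bool) (b : Bool)
    (h : HasMatching (SimpleGraph.fromEdgeSet {e | c e = b}) t) :
    MatchingCopy n c t (if b then t else 0) := by
  obtain ⟨f, hf, hadj⟩ := h
  refine ⟨f, hf, ?_⟩
  have hc : ∀ i, c s((f i).1, (f i).2) = b := fun i => by
    have := hadj i
    rw [SimpleGraph.fromEdgeSet_adj] at this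
    exact this.1
  cases b <;> simp [hc]

theorem ncard_edgeSet_fromEdgeSet {n : ℕ} (c : Sym2 (Fin n) → Bool) (b : Bool) :
    (SimpleGraph.fromEdgeSet {e | c e = b}).edgeSet.ncard =
      ((⊤ : SimpleGraph (Fin n)).edgeFinset.filter (fun e => c e = b)).card := by
  rw [← Set.ncard_coe_finset]
  congr 1
  ext e
  simp [and_comm]

theorem matchingCopy_of_lt_min {n s k r : ℕ} {c : Sym2 (Fin n) → Bool} (hn : 5 * s ≤ n)
    (hc : s.choose 2 + s * (n - s) < min (redEdges n c).card (blueEdges n c).card)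
    (hk : 2 * (s + 1 + k) < n) (hkr : k ≤ r) (hr : r ≤ s + 1) :
    MatchingCopy n c (s + 1 + k) r := by
  obtain ⟨hred, hblue⟩ := lt_min_iff.mp hc
  have h₁ := matchingCopy_of_hasMatching_fromEdgeSet c true (hasMatching_of_lt_ncard_edgeSet hn _
    (by rwa [ncard_edgeSet_fromEdgeSet]))
  have h₂ := matchingCopy_of_hasMatching_fromEdgeSet c false (hasMatching_of_lt_ncard_edgeSet hn _
    (by rwa [ncard_edgeSet_fromEdgeSet]))
  simp only [if_true, Bool.false_eq_true, if_false] at h₁ h₂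
  obtain ⟨r₁, hr₁, -, hm₁⟩ := h₁.add k hk.le
  obtain ⟨r₂, -, hr₂, hm₂⟩ := h₂.add k hk.le
  exact hm₂.of_le_of_le hk hm₁ (by omega) (by omega)

/-- The colouring whose red edges are those meeting the first `s` vertices. -/
def coverColouring (n s : ℕ) (e : Sym2 (Fin n)) : Bool :=
  decide (∃ x ∈ e, x.val < s)

theorem le_of_matchingCopy_coverColouring {n s m r : ℕ}
    (h : MatchingCopy n (coverColouring n s) m r) : r ≤ s := by
  obtain ⟨g, hg, rfl⟩ := matchingCopy_iff.mp h
  have hex : ∀ i ∈ Finset.univ.filter fun i : Fin m =>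
      coverColouring n s s(g (i, true), g (i, false)) = true, ∃ b, (g (i, b)).val < s := by
    intro i hi
    obtain ⟨x, hx, hxs⟩ : ∃ x ∈ s(g (i, true), g (i, false)), x.val < s := by
      simpa [coverColouring] using hi
    rcases Sym2.mem_iff.mp hx with rfl | rfl
    · exact ⟨_, hxs⟩
    · exact ⟨_, hxs⟩
  choose! b hb using hex
  have hle := Finset.card_le_card_of_injOn (t := Finset.range s) (fun i => (g (i, b i)).val)
    (fun i hi => by simpa using hb i hi)
    (fun i _ j _ hij => congrArg Prod.fst (hg (Fin.ext hij)))
  rw [Finset.card_range] at hle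
  exact hle

theorem card_blueEdges_coverColouring {s p : ℕ} :
    (blueEdges (s + p) (coverColouring (s + p) s)).card = p.choose 2 := by
  have hcard : (Finset.univ.filter fun x : Fin (s + p) => s ≤ x.val).card = p := by
    have : (Finset.univ.filter fun x : Fin (s + p) => s ≤ x.val) =
        Finset.univ.map (Fin.natAddEmb s) := by
      ext x
      simp only [Finset.mem_filter, Finset.mem_univ, true_and, Finset.mem_map]
      constructor
      · intro hx
        exact ⟨⟨x.val - s, by omega⟩, Fin.ext (by simp; omega)⟩
      · rintro ⟨y, rfl⟩
        simp
    simp [this]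
  rw [← hcard, ← Sym2.card_image_offDiag, hcard]
  congr 1
  ext e
  induction e using Sym2.ind with
  | _ u v =>
    simp only [blueEdges, coverColouring, Finset.mem_filter, Finset.mem_image, Finset.mem_offDiag,
      Prod.exists, SimpleGraph.mem_edgeFinset, SimpleGraph.mem_edgeSet, SimpleGraph.top_adj,
      decide_eq_false_iff_not, Sym2.mem_iff, not_exists, not_and, not_lt, Finset.mem_univ,
      true_and, Function.uncurry_apply_pair]
    constructor
    · rintro ⟨huv, h⟩
      exact ⟨u, v, ⟨h u (Or.inl rfl), h v (Or.inr rfl), huv⟩, rfl⟩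
    · rintro ⟨a, b, ⟨ha, hb, hab⟩, h⟩
      rcases Sym2.eq_iff.mp h with ⟨rfl, rfl⟩ | ⟨rfl, rfl⟩
      · exact ⟨hab, by rintro x (rfl | rfl) <;> assumption⟩
      · exact ⟨hab.symm, by rintro x (rfl | rfl) <;> assumption⟩

theorem card_redEdges_coverColouring {s p : ℕ} :
    (redEdges (s + p) (coverColouring (s + p) s)).card = s.choose 2 + s * p := by
  have h := Finset.card_filter_add_card_filter_not (s := (⊤ : SimpleGraph (Fin (s + p))).edgeFinset)
    (fun e => coverColouring (s + p) s e = true)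
  simp only [Bool.not_eq_true] at h
  have hb := card_blueEdges_coverColouring (s := s) (p := p)
  rw [SimpleGraph.card_edgeFinset_top_eq_card_choose_two, Fintype.card_fin, choose_two_add] at h
  unfold blueEdges at hb
  unfold redEdges
  omega

theorem le_min_coverColouring {s n : ℕ} (hn : 4 * s + 1 ≤ n) :
    s.choose 2 + s * (n - s) ≤ min (redEdges n (coverColouring n s)).card
      (blueEdges n (coverColouring n s)).card := by
  obtain ⟨p, rfl⟩ := Nat.exists_eq_add_of_le (by omega : s ≤ n)
  rw [card_redEdges_coverColouring, card_blueEdges_coverColouring, Nat.add_sub_cancel_left]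
  obtain ⟨q, rfl⟩ := Nat.exists_eq_add_of_le (by omega : 3 * s + 1 ≤ p)
  refine le_min le_rfl ?_
  have h₂ := choose_two_add s (2 * s + 1 + q)
  have h₃ := choose_two_add s (s + 1 + q)
  have h₄ := choose_two_add s (1 + q)
  rw [show s + (2 * s + 1 + q) = 3 * s + 1 + q by ring] at h₂
  rw [show s + (s + 1 + q) = 2 * s + 1 + q by ring] at h₃
  rw [show s + (1 + q) = s + 1 + q by ring] at h₄
  have h₅ : 2 * s.choose 2 + s = s * s := by
    clear * -
    induction s with
    | zero => rfl
    | succ s ih =>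
      have := choose_two_add s 1
      simp only [mul_one, show Nat.choose 1 2 = 0 from rfl] at this
      rw [this]
      linarith
  rw [h₂, h₃, h₄]
  nlinarith [Nat.zero_le (s * q), Nat.zero_le ((1 + q).choose 2)]

theorem sInf_eq_of_forall_lt_min {n s : ℕ} (hn : 4 * s + 1 ≤ n)
    {P : (Sym2 (Fin n) → Bool) → Prop}
    (h : ∀ c, s.choose 2 + s * (n - s) < min (redEdges n c).card (blueEdges n c).card → P c)
    (hcover : ¬ P (coverColouring n s)) :
    sInf {k : ℕ | ∀ c : Sym2 (Fin n) → Bool,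
      k < min (redEdges n c).card (blueEdges n c).card → P c} = s.choose 2 + s * (n - s) := by
  refine le_antisymm (Nat.sInf_le h) (le_csInf ⟨_, h⟩ fun k hk => ?_)
  by_contra! hlt
  exact hcover (hk _ (hlt.trans_le (le_min_coverColouring hn)))

theorem exMatching_eq {n s : ℕ} (hn : 5 * s ≤ n) :
    exMatching n (s + 1) = s.choose 2 + s * (n - s) := by
  refine IsGreatest.csSup_eq ⟨?_, ?_⟩
  · refine ⟨SimpleGraph.fromEdgeSet {e | coverColouring n s e = true}, fun h => ?_, ?_⟩
    · have := le_of_matchingCopy_coverColouring (matchingCopy_of_hasMatching_fromEdgeSet _ true h)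
      simp at this
    · obtain ⟨p, rfl⟩ := Nat.exists_eq_add_of_le (by omega : s ≤ n)
      rw [ncard_edgeSet_fromEdgeSet, Nat.add_sub_cancel_left]
      exact card_redEdges_coverColouring
  · rintro k ⟨A, hA, rfl⟩
    by_contra! hlt
    exact hA (hasMatching_of_lt_ncard_edgeSet hn A hlt)

/-- For every `t ≥ 1` and every `n ≥ 7t-1`,
`sbal(n,(2t-1)K_2) = bal(n,2tK_2) = bal(n,(2t+1)K_2) = ex(n,tK_2)
  = C(t-1,2) + (t-1)(n-t+1)`. -/
theorem sbal_bal_matchings_eq_turan (t : ℕ) (ht : 1 ≤ t) (n : ℕ) (hn : 7 * t - 1 ≤ n) :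
    sbalMatching n (2 * t - 1) = balMatching n (2 * t) ∧
    balMatching n (2 * t) = balMatching n (2 * t + 1) ∧
    balMatching n (2 * t + 1) = exMatching n t ∧
    exMatching n t = Nat.choose (t - 1) 2 + (t - 1) * (n - t + 1) := by
  obtain ⟨s, rfl⟩ := Nat.exists_eq_add_of_le' ht
  have hex := exMatching_eq (n := n) (s := s) (by omega)
  have hs : sbalMatching n (2 * (s + 1) - 1) = s.choose 2 + s * (n - s) := by
    refine sInf_eq_of_forall_lt_min (by omega) (fun c hc => ?_) fun h => ?_
    · rw [show 2 * (s + 1) - 1 = s + 1 + s by omega]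
      exact ⟨matchingCopy_of_lt_min (by omega) hc (by omega) (by omega) (by omega),
        matchingCopy_of_lt_min (by omega) hc (by omega) (by omega) (by omega)⟩
    · have := le_of_matchingCopy_coverColouring h.2
      omega
  have hb : balMatching n (2 * (s + 1)) = s.choose 2 + s * (n - s) := by
    refine sInf_eq_of_forall_lt_min (by omega) (fun c hc => Or.inl ?_) fun h => ?_
    · rw [show 2 * (s + 1) = s + 1 + (s + 1) by omega]
      exact matchingCopy_of_lt_min (by omega) hc (by omega) (by omega) (by omega)
    · rcases h with h | h <;>
      · have := le_of_matchingCopy_coverColouring h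
        omega
  have hb' : balMatching n (2 * (s + 1) + 1) = s.choose 2 + s * (n - s) := by
    refine sInf_eq_of_forall_lt_min (by omega) (fun c hc => ?_) fun h => ?_
    · have := matchingCopy_of_lt_min (k := s + 1) (r := s + 1) (by omega) hc (by omega) (by omega)
        (by omega)
      convert this.succ (by omega) using 2 <;> omega
    · rcases h with h | h <;>
      · have := le_of_matchingCopy_coverColouring h
        omega
  rw [hs, hb, hb', hex, Nat.add_sub_cancel, show n - (s + 1) + 1 = n - s by omega]
  exact ⟨rfl, rfl, rfl, rfl⟩
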